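/- Let D be a quadrangulation of the (2s+2)-gon with quiddity numbers q_0,…,q_{2s+1}. Then row 3 of the frieze F_D of type Λ_4 and row 3 of the Conway–Coxeter frieze F_{T_D} of the associated triangulation coincide: both have entries 2 q_k q_{k+1} − 1 (indices taken modulo 2s+2), and these entries are positive integers. -/

import Mathlib

namespace FriezeNote

/-- `x` lies strictly between `a` and `b`, going in the positive direction
around the vertices `0, 1, …, m-1` of the `m`-gon. -/
def StrictBtw (m : ℕ) (a x b : ZMod m) : Prop :=
  0 < (x - a).val ∧ (x - a).val < (b - a).val

/-- Two chords of the `m`-gon cross (in the interior of the polygon). -/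
def Crosses (m : ℕ) (e f : Sym2 (ZMod m)) : Prop :=
  ∃ a b c d : ZMod m, e = s(a, b) ∧ f = s(c, d) ∧
    StrictBtw m a c b ∧ StrictBtw m b d a

/-- `e` is a diagonal of the `m`-gon: its endpoints are distinct and non-adjacent. -/
def IsDiagonal (m : ℕ) (e : Sym2 (ZMod m)) : Prop :=
  ∃ a b : ZMod m, e = s(a, b) ∧ a ≠ b ∧ b ≠ a + 1 ∧ a ≠ b + 1

/-- `e` is a boundary edge of the `m`-gon. -/
def IsPolyEdge (m : ℕ) (e : Sym2 (ZMod m)) : Prop :=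
  ∃ a : ZMod m, e = s(a, a + 1)

/-- A dissection of the `m`-gon: a set of pairwise non-crossing diagonals. -/
def IsDissection (m : ℕ) (D : Set (Sym2 (ZMod m))) : Prop :=
  (∀ e ∈ D, IsDiagonal m e) ∧ ∀ e ∈ D, ∀ f ∈ D, ¬ Crosses m e f

/-- `b` is the cyclic successor of `a` among the vertices of the finite set `C`:
both lie in `C` and no element of `C` lies strictly between them. -/
def CycConsec (m : ℕ) (C : Finset (ZMod m)) (a b : ZMod m) : Prop :=
  a ∈ C ∧ b ∈ C ∧ a ≠ b ∧ ∀ x ∈ C, ¬ StrictBtw m a x b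

/-- `C` is the vertex set of one of the subpolygons (cells) into which the
dissection `D` splits the `m`-gon: it has at least `3` vertices, cyclically
consecutive vertices of `C` are joined by a diagonal of `D` or a boundary edge,
and any diagonal of `D` with both endpoints in `C` joins cyclically consecutive
vertices of `C`. -/
def IsCell (m : ℕ) (D : Set (Sym2 (ZMod m))) (C : Finset (ZMod m)) : Prop :=
  3 ≤ C.card ∧
  (∀ a b : ZMod m, CycConsec m C a b → (s(a, b) ∈ D ∨ IsPolyEdge m s(a, b))) ∧
  (∀ a b : ZMod m, a ∈ C → b ∈ C → s(a, b) ∈ D →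
    (CycConsec m C a b ∨ CycConsec m C b a))

/-- `D` is a `p`-angulation of the `m`-gon: a dissection all of whose
subpolygons are `p`-gons. -/
def IsPAngulation (m p : ℕ) (D : Set (Sym2 (ZMod m))) : Prop :=
  IsDissection m D ∧ ∀ C : Finset (ZMod m), IsCell m D C → C.card = p

/-- The number of subpolygons of the dissection `D` incident with the vertex `α`. -/
noncomputable def cellCount (m : ℕ) (D : Set (Sym2 (ZMod m))) (α : ZMod m) : ℕ :=
  {C : Finset (ZMod m) | IsCell m D C ∧ α ∈ C}.ncard

/-- A frieze pattern of width `n`: rows numbered `0, …, n + 3` from below (entries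
of rows beyond `n + 3` are irrelevant), each row indexed by `ℤ`, rows `0` and
`n + 3` are zeroes, rows `1` and `n + 2` are ones, rows `2` through `n + 1` are
positive, and every diamond `b` (top), `a` (left), `d` (right), `c` (bottom)
satisfies `a * d - b * c = 1`. -/
structure Frieze (n : ℕ) where
  entry : ℕ → ℤ → ℝ
  nonneg : ∀ i k, i ≤ n + 3 → 0 ≤ entry i k
  row_zero : ∀ k, entry 0 k = 0
  row_top : ∀ k, entry (n + 3) k = 0
  row_one : ∀ k, entry 1 k = 1
  row_penult : ∀ k, entry (n + 2) k = 1
  row_pos : ∀ i k, 2 ≤ i → i ≤ n + 1 → 0 < entry i k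
  diamond : ∀ i k, 1 ≤ i → i ≤ n + 2 →
    entry i k * entry i (k + 1) - entry (i + 1) k * entry (i - 1) (k + 1) = 1

/-- `λ_p = 2 cos (π / p)`. -/
noncomputable def lambda (p : ℕ) : ℝ := 2 * Real.cos (Real.pi / p)

/-- A frieze pattern is of type `Λ_p` if every entry of its quiddity row (row `2`)
is a positive integral multiple of `λ_p`. -/
def IsTypeLambda (p : ℕ) {n : ℕ} (F : Frieze n) : Prop :=
  ∀ k : ℤ, ∃ q : ℕ, 0 < q ∧ F.entry 2 k = (q : ℝ) * lambda p

/-- `F` is the frieze of type `Λ_p` associated to the `p`-angulation `D` of the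
`m`-gon: its quiddity row is the periodic sequence `(λ_p q_0, …, λ_p q_{m-1})`. -/
def FriezeOfPAng (p m : ℕ) {n : ℕ} (F : Frieze n) (D : Set (Sym2 (ZMod m))) : Prop :=
  ∀ k : ℤ, F.entry 2 k = lambda p * (cellCount m D (k : ZMod m) : ℝ)

/-- `F` is the Conway–Coxeter frieze of the triangulation `T` of the `m`-gon:
its quiddity row is the periodic sequence `(t_0, …, t_{m-1})` where `t_α` is the
number of triangles of `T` incident with the vertex `α`. -/
def CCFrieze (m : ℕ) {n : ℕ} (F : Frieze n) (T : Set (Sym2 (ZMod m))) : Prop :=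
  ∀ k : ℤ, F.entry 2 k = (cellCount m T (k : ZMod m) : ℝ)

/-- A vertex of the `m`-gon is black when its label is odd (vertices are coloured
alternately, odd vertices black and even vertices white). -/
def IsBlack (m : ℕ) (a : ZMod m) : Prop := a.val % 2 = 1

/-- The set of chords joining two distinct black (odd) vertices of a common
subpolygon of the dissection `D`. -/
def oddPairs (m : ℕ) (D : Set (Sym2 (ZMod m))) : Set (Sym2 (ZMod m)) :=
  {e | ∃ (C : Finset (ZMod m)) (a b : ZMod m),
    IsCell m D C ∧ e = s(a, b) ∧ a ∈ C ∧ b ∈ C ∧ a ≠ b ∧ IsBlack m a ∧ IsBlack m b}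

/-- The triangulation associated to a dissection `D`: the diagonals of `D`
together with, inside each subpolygon, the chords joining pairs of its odd
(black) vertices. -/
def assocTriangulation (m : ℕ) (D : Set (Sym2 (ZMod m))) : Set (Sym2 (ZMod m)) :=
  D ∪ oddPairs m D

/-- `E` is a noncrossing tree on the black (odd) vertices of the `m`-gon:
its edges join distinct black vertices, are pairwise non-crossing, any two black
vertices are connected by a sequence of edges, and there is no loop of edges. -/
def IsNoncrossingTree (m : ℕ) (E : Set (Sym2 (ZMod m))) : Prop :=
  (∀ e ∈ E, ∃ a b : ZMod m, e = s(a, b) ∧ a ≠ b ∧ IsBlack m a ∧ IsBlack m b) ∧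
  (∀ e ∈ E, ∀ f ∈ E, ¬ Crosses m e f) ∧
  (∀ a b : ZMod m, IsBlack m a → IsBlack m b →
    (SimpleGraph.fromEdgeSet E).Reachable a b) ∧
  (SimpleGraph.fromEdgeSet E).IsAcyclic

/-- The inverse of the tree-of-quadrangulation map: it sends a noncrossing tree
`E` to the set of all black–white diagonals crossing no edge of `E`. -/
def quadOfTree (m : ℕ) (E : Set (Sym2 (ZMod m))) : Set (Sym2 (ZMod m)) :=
  {e | IsDiagonal m e ∧
    (∃ a b : ZMod m, e = s(a, b) ∧ IsBlack m a ∧ ¬ IsBlack m b) ∧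
    ∀ f ∈ E, ¬ Crosses m e f}

/-- `e` is a diagonal of the subpolygon with vertex set `C`: both endpoints are
distinct vertices of `C` which are not cyclically consecutive in `C`. -/
def CellDiagonal (m : ℕ) (C : Finset (ZMod m)) (e : Sym2 (ZMod m)) : Prop :=
  ∃ a b : ZMod m, e = s(a, b) ∧ a ∈ C ∧ b ∈ C ∧ a ≠ b ∧
    ¬ CycConsec m C a b ∧ ¬ CycConsec m C b a

/-- `e` is an edge of the subpolygon with vertex set `C`: it joins two
cyclically consecutive vertices of `C`. -/
def CellEdge (m : ℕ) (C : Finset (ZMod m)) (e : Sym2 (ZMod m)) : Prop :=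
  ∃ a b : ZMod m, e = s(a, b) ∧ (CycConsec m C a b ∨ CycConsec m C b a)

/-- `C` is an ear of the dissection `D`: a subpolygon all of whose edges except
exactly one are boundary edges of the polygon. -/
def IsEar (m : ℕ) (D : Set (Sym2 (ZMod m))) (C : Finset (ZMod m)) : Prop :=
  IsCell m D C ∧ ∃! e : Sym2 (ZMod m), CellEdge m C e ∧ ¬ IsPolyEdge m e

/-- The dual graph of a dissection `D`: vertices are the subpolygons of `D`, and
two subpolygons are adjacent when they share a common edge (a diagonal of `D`). -/
def dualGraph (m : ℕ) (D : Set (Sym2 (ZMod m))) :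
    SimpleGraph {C : Finset (ZMod m) // IsCell m D C} :=
  SimpleGraph.fromRel fun C C' =>
    ∃ e ∈ D, ∃ a b : ZMod m, e = s(a, b) ∧
      a ∈ C.1 ∧ b ∈ C.1 ∧ a ∈ C'.1 ∧ b ∈ C'.1

section Helpers

set_option linter.unusedSectionVars false

variable {m : ℕ} [NeZero m]

theorem valsub (a b : ZMod m) :
    (b.val ≤ a.val ∧ (a - b).val = a.val - b.val) ∨
    (a.val < b.val ∧ (a - b).val = a.val + m - b.val) := by
  rcases le_or_gt b.val a.val with h | h
  · exact Or.inl ⟨h, ZMod.val_sub h⟩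
  · right
    refine ⟨h, ?_⟩
    have h1 := ZMod.val_lt (a - b)
    have h2 := ZMod.val_lt b
    have h3 := ZMod.val_lt a
    have h5 : (a - b) + b = a := by ring
    rcases lt_or_ge ((a - b).val + b.val) m with h4 | h4
    · have := ZMod.val_add_of_lt h4
      rw [h5] at this
      omega
    · have := ZMod.val_add_val_of_le h4
      rw [h5] at this
      omega

/-- rotated coordinate -/
def R (o v : ZMod m) : ℕ := (v - o).val

theorem R_inj (o : ZMod m) {u v : ZMod m} (h : R o u = R o v) : u = v := by
  have := ZMod.val_injective m h
  exact sub_left_injective this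

theorem R_lt (o u : ZMod m) : R o u < m := ZMod.val_lt _

theorem R_self (o : ZMod m) : R o o = 0 := by simp [R]

theorem R_zero {o v : ZMod m} (h : R o v = 0) : v = o := by
  apply R_inj o; rw [h, R_self]

theorem R_sub (o a x : ZMod m) :
    (R o a ≤ R o x ∧ (x - a).val = R o x - R o a) ∨
    (R o x < R o a ∧ (x - a).val = R o x + m - R o a) := by
  have := valsub (x - o) (a - o)
  have h : x - o - (a - o) = x - a := by ring
  rw [h] at this
  exact this

theorem sb_iff (o a x b : ZMod m) : StrictBtw m a x b ↔
    (R o a < R o x ∧ R o x < R o b) ∨ (R o x < R o b ∧ R o b < R o a) ∨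
    (R o b < R o a ∧ R o a < R o x) := by
  unfold StrictBtw
  have h1 := R_sub o a x
  have h2 := R_sub o a b
  have := R_lt o a
  have := R_lt o b
  have := R_lt o x
  omega

theorem R_succ {o u v : ZMod m} (hm : 2 ≤ m) (h : R o v = R o u + 1) : v = u + 1 := by
  have h1 := R_sub o u v
  have h2 : (v - u).val = 1 := by omega
  have : Fact (1 < m) := ⟨hm⟩
  have h3 : (1 : ZMod m).val = 1 := ZMod.val_one m
  have h4 : v - u = 1 := ZMod.val_injective m (by rw [h2, h3])
  rw [← h4]; ring

theorem val_succ_sub (hm : 2 ≤ m) (u : ZMod m) : ((u + 1) - u).val = 1 := by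
  have : Fact (1 < m) := ⟨hm⟩
  have h3 : (1 : ZMod m).val = 1 := ZMod.val_one m
  have : u + 1 - u = 1 := by ring
  rw [this, h3]

theorem not_btw_succ (hm : 2 ≤ m) (u x : ZMod m) : ¬ StrictBtw m u x (u + 1) := by
  unfold StrictBtw
  rw [val_succ_sub hm]
  omega

theorem R_ne (o : ZMod m) {u v : ZMod m} (h : u ≠ v) : R o u ≠ R o v := fun h' => h (R_inj o h')

theorem sb_ne {a x b : ZMod m} (h : StrictBtw m a x b) : a ≠ x ∧ x ≠ b ∧ a ≠ b := by
  rw [sb_iff 0] at h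
  refine ⟨?_, ?_, ?_⟩ <;> rintro rfl <;> omega

/-- trichotomy for three distinct points -/
theorem sb_or {a x b : ZMod m} (h1 : a ≠ x) (h2 : x ≠ b) (h3 : a ≠ b) :
    StrictBtw m a x b ∨ StrictBtw m b x a := by
  rw [sb_iff 0, sb_iff 0]
  have := R_ne 0 h1
  have := R_ne 0 h2
  have := R_ne 0 h3
  omega

theorem exists_succ {C : Finset (ZMod m)} (hC : 2 ≤ C.card) {a : ZMod m} (ha : a ∈ C) :
    ∃ b, CycConsec m C a b := by
  have h : (C.erase a).Nonempty := by
    rw [← Finset.card_pos, Finset.card_erase_of_mem ha]; omega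
  obtain ⟨b, hb, hmin⟩ := Finset.exists_min_image _ (R a) h
  rw [Finset.mem_erase] at hb
  refine ⟨b, ha, hb.2, hb.1.symm, fun x hx hs => ?_⟩
  have hne := sb_ne hs
  have := hmin x (Finset.mem_erase.2 ⟨hne.1.symm, hx⟩)
  rw [sb_iff a, R_self] at hs
  omega

theorem exists_gap {C : Finset (ZMod m)} (hC : 2 ≤ C.card) {p : ZMod m} (hp : p ∉ C) :
    ∃ u v, CycConsec m C u v ∧ StrictBtw m u p v := by
  have h : C.Nonempty := by
    rw [← Finset.card_pos]; omega
  obtain ⟨v, hv, hmin⟩ := Finset.exists_min_image _ (R p) h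
  obtain ⟨u, hu, hmax⟩ := Finset.exists_max_image _ (R p) h
  have huv : u ≠ v := by
    rintro rfl
    have : C ⊆ {u} := by
      intro x hx
      rw [Finset.mem_singleton]
      exact R_inj p (le_antisymm (hmax x hx) (hmin x hx))
    have := Finset.card_le_card this
    simp at this
    omega
  have h1 := R_ne p huv
  have h2 := hmin u hu
  have h3 : R p v ≠ 0 := fun h => hp (R_zero h ▸ hv)
  refine ⟨u, v, ⟨hu, hv, huv, fun x hx hs => ?_⟩, ?_⟩
  · rw [sb_iff p] at hs
    have := hmin x hx
    have := hmax x hx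
    omega
  · rw [sb_iff p, R_self]
    omega

theorem succ_unique {C : Finset (ZMod m)} {a b b' : ZMod m} (h : CycConsec m C a b)
    (h' : CycConsec m C a b') : b = b' := by
  by_contra hne
  have h1 := h.2.2.2 b' h'.2.1
  have h2 := h'.2.2.2 b h.2.1
  rw [sb_iff a, R_self] at h1 h2
  have := R_ne a hne
  have := R_ne a h.2.2.1
  have := R_ne a h'.2.2.1
  rw [R_self] at *
  omega

theorem pred_unique {C : Finset (ZMod m)} {a b b' : ZMod m} (h : CycConsec m C b a)
    (h' : CycConsec m C b' a) : b = b' := by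
  by_contra hne
  have h1 := h.2.2.2 b' h'.1
  have h2 := h'.2.2.2 b h.1
  rw [sb_iff a, R_self] at h1 h2
  have := R_ne a hne
  have := R_ne a h.2.2.1
  have := R_ne a h'.2.2.1
  rw [R_self] at *
  omega

theorem no_both {C : Finset (ZMod m)} (hC : 3 ≤ C.card) {a b : ZMod m} (h : CycConsec m C a b)
    (h' : CycConsec m C b a) : False := by
  have : C ⊆ {a, b} := by
    intro x hx
    rw [Finset.mem_insert, Finset.mem_singleton]
    by_contra hcon
    push Not at hcon
    rcases sb_or hcon.1.symm hcon.2 h.2.2.1 with hh | hh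
    · exact h.2.2.2 x hx hh
    · exact h'.2.2.2 x hx hh
  have h1 := Finset.card_le_card this
  have h2 : ({a, b} : Finset (ZMod m)).card ≤ 2 := Finset.card_le_two
  omega

variable {D : Set (Sym2 (ZMod m))}

theorem D_symm {a b : ZMod m} (h : s(a, b) ∈ D) : s(b, a) ∈ D := by
  rwa [Sym2.eq_swap]

theorem NC (hD : IsDissection m D) {a b c d : ZMod m} (h1 : s(a, b) ∈ D) (h2 : s(c, d) ∈ D)
    (h3 : StrictBtw m a c b) (h4 : StrictBtw m b d a) : False :=
  hD.2 _ h1 _ h2 ⟨a, b, c, d, rfl, rfl, h3, h4⟩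

theorem D_diag (hD : IsDissection m D) {a b : ZMod m} (h : s(a, b) ∈ D) :
    a ≠ b ∧ b ≠ a + 1 ∧ a ≠ b + 1 := by
  obtain ⟨c, d, he, h1, h2, h3⟩ := hD.1 _ h
  rw [Sym2.eq_iff] at he
  rcases he with ⟨rfl, rfl⟩ | ⟨rfl, rfl⟩
  · exact ⟨h1, h2, h3⟩
  · exact ⟨h1.symm, h3, h2⟩

theorem polyEdge_iff {a b : ZMod m} : IsPolyEdge m s(a, b) ↔ b = a + 1 ∨ a = b + 1 := by
  constructor
  · rintro ⟨c, hc⟩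
    rw [Sym2.eq_iff] at hc
    rcases hc with ⟨rfl, rfl⟩ | ⟨rfl, rfl⟩
    · left; rfl
    · right; rfl
  · rintro (rfl | rfl)
    · exact ⟨a, rfl⟩
    · exact ⟨b, Sym2.eq_swap⟩

/-- Consecutive vertices of a cell: a diagonal or a positively oriented edge. -/
theorem consec_edge (hm : 2 ≤ m) {C : Finset (ZMod m)} (hC : IsCell m D C) {a b : ZMod m}
    (h : CycConsec m C a b) : s(a, b) ∈ D ∨ b = a + 1 := by
  rcases hC.2.1 a b h with h1 | h1
  · exact Or.inl h1
  · rcases polyEdge_iff.1 h1 with h2 | h2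
    · exact Or.inr h2
    · exfalso
      refine no_both hC.1 h ⟨h.2.1, h.1, h.2.2.1.symm, fun x _ hs => ?_⟩
      subst h2
      exact not_btw_succ hm _ _ hs

theorem gap_D (hm : 2 ≤ m) {C : Finset (ZMod m)} (hC : IsCell m D C) {p : ZMod m} (hp : p ∉ C) :
    ∃ u v, CycConsec m C u v ∧ StrictBtw m u p v ∧ s(u, v) ∈ D := by
  obtain ⟨u, v, h1, h2⟩ := exists_gap (by have := hC.1; omega) hp
  refine ⟨u, v, h1, h2, ?_⟩
  rcases consec_edge hm hC h1 with h | h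
  · exact h
  · subst h
    exact absurd h2 (not_btw_succ hm _ _)

theorem sep_aux (hm : 2 ≤ m) (hD : IsDissection m D) {C : Finset (ZMod m)} (hC : IsCell m D C)
    {a b p q : ZMod m} (h : s(a, b) ∈ D) (hp : p ∈ C) (hq : q ∈ C)
    (h1 : StrictBtw m a p b) (h2 : StrictBtw m b q a) (ha : a ∉ C) : False := by
  obtain ⟨u, v, h3, h4, h5⟩ := gap_D hm hC ha
  have h6 := h3.2.2.2 p hp
  have h7 := h3.2.2.2 q hq
  have h8 : ¬ StrictBtw m v b u := fun hh => NC hD h5 h h4 hh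
  rw [sb_iff a, R_self] at *
  omega

/-- A cell lies on one side of each diagonal. -/
theorem sep (hm : 2 ≤ m) (hD : IsDissection m D) {C : Finset (ZMod m)} (hC : IsCell m D C)
    {a b p q : ZMod m} (h : s(a, b) ∈ D) (hp : p ∈ C) (hq : q ∈ C)
    (h1 : StrictBtw m a p b) (h2 : StrictBtw m b q a) : False := by
  by_cases ha : a ∈ C
  · by_cases hb : b ∈ C
    · rcases hC.2.2 a b ha hb h with h3 | h3
      · exact h3.2.2.2 p hp h1
      · exact h3.2.2.2 q hq h2
    · exact sep_aux hm hD hC (D_symm h) hq hp h2 h1 hb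
  · exact sep_aux hm hD hC h hp hq h1 h2 ha

theorem cell_diff (hm : 2 ≤ m) (hD : IsDissection m D) {C C' : Finset (ZMod m)}
    (hC : IsCell m D C) (hC' : IsCell m D C') {p : ZMod m} (hp : p ∈ C) (hp' : p ∉ C') :
    ∃ u v, CycConsec m C' u v ∧ StrictBtw m u p v ∧ s(u, v) ∈ D ∧
      ∀ x ∈ C, x ∈ C' → x = u ∨ x = v := by
  obtain ⟨u, v, h1, h2, h3⟩ := gap_D hm hC' hp'
  refine ⟨u, v, h1, h2, h3, fun x hx hx' => ?_⟩
  by_contra hcon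
  push Not at hcon
  rcases sb_or hcon.1.symm hcon.2 h1.2.2.1 with h | h
  · exact h1.2.2.2 x hx' h
  · exact sep hm hD hC h3 hp hx h2 h

theorem cell_sub (hm : 2 ≤ m) (hD : IsDissection m D) {C C' : Finset (ZMod m)}
    (hC : IsCell m D C) (hC' : IsCell m D C') {a b : ZMod m} (h : CycConsec m C a b)
    (h' : CycConsec m C' a b) : C ⊆ C' := by
  intro p hp
  by_contra hp'
  obtain ⟨u, v, h1, h2, h3, h4⟩ := cell_diff hm hD hC hC' hp hp'
  have hab := h.2.2.1
  rcases h4 a h.1 h'.1 with ha | ha <;> rcases h4 b h.2.1 h'.2.1 with hb | hb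
  · exact hab (ha.trans hb.symm)
  · subst ha hb
    exact h.2.2.2 p hp h2
  · subst ha hb
    exact no_both hC'.1 h1 h'
  · exact hab (ha.trans hb.symm)

theorem cell_unique (hm : 2 ≤ m) (hD : IsDissection m D) {C C' : Finset (ZMod m)}
    (hC : IsCell m D C) (hC' : IsCell m D C') {a b : ZMod m} (h : CycConsec m C a b)
    (h' : CycConsec m C' a b) : C = C' :=
  Finset.Subset.antisymm (cell_sub hm hD hC hC' h h') (cell_sub hm hD hC' hC h' h)

open Classical in
theorem cell_exists (hm : 2 ≤ m) (hD : IsDissection m D) {a b : ZMod m} (hab : a ≠ b)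
    (hb : b ≠ a + 1) (h : s(a, b) ∈ D ∨ a = b + 1) :
    ∃ C, IsCell m D C ∧ CycConsec m C b a := by
  set C : Finset (ZMod m) := Finset.univ.filter (fun v => R a v ≤ R a b ∧
    ∀ c d, s(c, d) ∈ D → R a c < R a v → R a v < R a d → R a d ≤ R a b → (c = a ∧ d = b)) with hCdef
  have memC : ∀ v, v ∈ C ↔ (R a v ≤ R a b ∧
    ∀ c d, s(c, d) ∈ D → R a c < R a v → R a v < R a d → R a d ≤ R a b → (c = a ∧ d = b)) := by
    intro v; simp [hCdef]
  have haC : a ∈ C := by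
    rw [memC]
    refine ⟨by rw [R_self]; omega, fun c d _ h1 => ?_⟩
    rw [R_self] at h1; omega
  have hbC : b ∈ C := by
    rw [memC]
    refine ⟨le_rfl, fun c d _ h1 h2 h3 => by omega⟩
  have hn : 0 < R a b := by
    rcases Nat.eq_zero_or_pos (R a b) with h0 | h0
    · exact absurd (R_zero h0).symm hab
    · exact h0
  have key : ∀ u v, CycConsec m C u v → R a u < R a v →
      v = u + 1 ∨ (s(u, v) ∈ D ∧ ¬ (u = a ∧ v = b)) := by
    intro u v huv hlt
    obtain ⟨hu, hv, huv1, hno⟩ := huv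
    have hu' := (memC u).1 hu
    have hv' := (memC v).1 hv
    by_cases h1 : R a v = R a u + 1
    · exact Or.inl (R_succ hm h1)
    right
    -- covering a point between
    have cover : ∀ w, R a u < R a w → R a w < R a v →
        ∃ c d, s(c, d) ∈ D ∧ R a c < R a w ∧ R a w < R a d ∧ R a d ≤ R a b ∧ ¬ (c = a ∧ d = b) := by
      intro w hw1 hw2
      have hw : w ∉ C := fun hw => hno w hw (by rw [sb_iff a]; omega)
      rw [memC] at hw
      push Not at hw
      obtain ⟨c, d, hh⟩ := hw (by omega)
      exact ⟨c, d, hh.1, hh.2.1, hh.2.2.1, hh.2.2.2.1, fun h => hh.2.2.2.2 h.1 h.2⟩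
    -- the set of good d
    have good : ∀ c d, s(c, d) ∈ D → R a c ≤ R a u → R a u < R a d → R a d ≤ R a b →
        ¬ (c = a ∧ d = b) → c = u ∧ R a d ≤ R a v := by
      intro c d hcd h2 h3 h4 h5
      have hc : R a c = R a u := by
        by_contra hne
        exact h5 (hu'.2 c d hcd (by omega) h3 h4)
      refine ⟨R_inj a hc, ?_⟩
      by_contra hlt'
      exact h5 (hv'.2 c d hcd (by omega) (by omega) h4)
    set S : Finset (ZMod m) := Finset.univ.filter (fun d => s(u, d) ∈ D ∧ R a u < R a d ∧
      R a d ≤ R a v ∧ ¬ (u = a ∧ d = b)) with hS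
    have memS : ∀ d, d ∈ S ↔ (s(u, d) ∈ D ∧ R a u < R a d ∧
      R a d ≤ R a v ∧ ¬ (u = a ∧ d = b)) := by intro d; simp [hS]
    have hne : S.Nonempty := by
      have hw : R a (u + 1) = R a u + 1 := by
        have h2 := R_sub a u (u + 1)
        rw [val_succ_sub hm] at h2
        have := R_lt a v
        omega
      obtain ⟨c, d, h2, h3, h4, h5, h6⟩ := cover (u + 1) (by omega) (by omega)
      obtain ⟨rfl, h7⟩ := good c d h2 (by omega) (by omega) h5 h6
      exact ⟨d, (memS d).2 ⟨h2, by omega, h7, h6⟩⟩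
    obtain ⟨d, hd, hmax⟩ := Finset.exists_max_image S (R a) hne
    obtain ⟨h2, h3, h4, h5⟩ := (memS d).1 hd
    by_cases hdv : R a d = R a v
    · have := R_inj a hdv
      subst this
      exact ⟨h2, h5⟩
    exfalso
    obtain ⟨c', d', g1, g2, g3, g4, g5⟩ := cover d h3 (by omega)
    have g6 : R a c' ≤ R a u := by
      by_contra hcon
      refine NC hD h2 g1 ?_ ?_ <;> rw [sb_iff a] <;> omega
    obtain ⟨rfl, g7⟩ := good c' d' g1 g6 (by omega) g4 g5
    have := hmax d' ((memS d').2 ⟨g1, by omega, g7, g5⟩)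
    omega
  have hba : CycConsec m C b a := by
    refine ⟨hbC, haC, hab.symm, fun x hx hs => ?_⟩
    have := ((memC x).1 hx).1
    rw [sb_iff a, R_self] at hs
    omega
  refine ⟨C, ⟨?_, ?_, ?_⟩, hba⟩
  · by_contra hcard
    have hsub : ({a, b} : Finset (ZMod m)) ⊆ C := by
      intro x hx
      rw [Finset.mem_insert, Finset.mem_singleton] at hx
      rcases hx with rfl | rfl <;> assumption
    have heq : ({a, b} : Finset (ZMod m)) = C := by
      apply Finset.eq_of_subset_of_card_le hsub
      rw [Finset.card_pair hab]; omega
    have : CycConsec m C a b := by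
      refine ⟨haC, hbC, hab, fun x hx hs => ?_⟩
      rw [← heq, Finset.mem_insert, Finset.mem_singleton] at hx
      have := sb_ne hs
      rcases hx with rfl | rfl
      · exact this.1 rfl
      · exact this.2.1 rfl
    rcases key a b this (by rw [R_self]; exact hn) with h1 | h1
    · exact hb h1
    · exact h1.2 ⟨rfl, rfl⟩
  · intro u v huv
    rcases lt_trichotomy (R a u) (R a v) with hlt | heq | hgt
    · rcases key u v huv hlt with h1 | h1
      · exact Or.inr (polyEdge_iff.2 (Or.inl h1))
      · exact Or.inl h1.1
    · exact absurd (R_inj a heq) huv.2.2.1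
    · have h1 := huv.2.2.2 a haC
      have h2 := huv.2.2.2 b hbC
      have h3 := ((memC u).1 huv.1).1
      rw [sb_iff a] at h1 h2
      rw [R_self] at h1
      have hv : v = a := R_zero (by omega)
      have hu : u = b := R_inj a (by omega)
      subst hu hv
      rcases h with h | h
      · exact Or.inl (D_symm h)
      · exact Or.inr (polyEdge_iff.2 (Or.inl h))
  · have main : ∀ c d, c ∈ C → d ∈ C → s(c, d) ∈ D → R a c < R a d →
        (CycConsec m C c d ∨ CycConsec m C d c) := by
      intro c d hc hd hcd hlt
      by_cases hcon : c = a ∧ d = b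
      · obtain ⟨rfl, rfl⟩ := hcon
        exact Or.inr hba
      · left
        refine ⟨hc, hd, (D_diag hD hcd).1, fun x hx hs => ?_⟩
        rw [sb_iff a] at hs
        have := ((memC d).1 hd).1
        exact hcon (((memC x).1 hx).2 c d hcd (by omega) (by omega) this)
    intro c d hc hd hcd
    rcases lt_trichotomy (R a c) (R a d) with hlt | heq | hgt
    · exact main c d hc hd hcd hlt
    · exact absurd (R_inj a heq) (D_diag hD hcd).1
    · exact (main d c hd hc (D_symm hcd) hgt).symm

theorem succ_ne (hm : 2 ≤ m) (a : ZMod m) : a + 1 ≠ a := by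
  intro h
  have h1 := val_succ_sub hm a
  rw [h] at h1
  simp at h1

theorem succ_succ_ne (hm : 3 ≤ m) (a : ZMod m) : a + 1 + 1 ≠ a := by
  intro h
  have h1 := val_succ_sub (by omega) a
  have h2 := val_succ_sub (by omega) (a + 1)
  rw [h] at h2
  have h3 := valsub (a + 1) a
  have h4 := valsub a (a + 1)
  have := ZMod.val_lt a
  have := ZMod.val_lt (a + 1)
  omega

theorem cellCount_eq (hm : 3 ≤ m) (hD : IsDissection m D) (α : ZMod m) :
    cellCount m D α = {β | s(α, β) ∈ D}.ncard + 1 := by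
  have hm2 : 2 ≤ m := by omega
  have hnot : α + 1 ∉ {β | s(α, β) ∈ D} := fun h => (D_diag hD h).2.1 rfl
  rw [← Set.ncard_insert_of_notMem hnot (Set.toFinite _)]
  have ex : ∀ β ∈ insert (α + 1) {β | s(α, β) ∈ D}, ∃ C, IsCell m D C ∧ CycConsec m C α β := by
    intro β hβ
    rcases hβ with rfl | hβ
    · exact cell_exists hm2 hD (succ_ne hm2 α) (succ_succ_ne hm α).symm (Or.inr rfl)
    · have := D_diag hD hβ
      exact cell_exists hm2 hD this.1.symm this.2.2 (Or.inl (D_symm hβ))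
  symm
  unfold cellCount
  refine Set.ncard_congr (fun β hβ => (ex β hβ).choose) ?_ ?_ ?_
  · intro β hβ
    have := (ex β hβ).choose_spec
    exact ⟨this.1, this.2.1⟩
  · intro β β' hβ hβ' heq
    have h1 := (ex β hβ).choose_spec
    have h2 := (ex β' hβ').choose_spec
    have heq' : (ex β hβ).choose = (ex β' hβ').choose := heq
    rw [heq'] at h1
    exact succ_unique h1.2 h2.2
  · rintro C ⟨hC, hα⟩
    obtain ⟨β, hβ⟩ := exists_succ (by have := hC.1; omega) hα
    have hmem : β ∈ insert (α + 1) {β | s(α, β) ∈ D} := by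
      rcases consec_edge hm2 hC hβ with h | h
      · exact Or.inr h
      · exact Or.inl h
    refine ⟨β, hmem, ?_⟩
    have h1 := (ex β hmem).choose_spec
    exact cell_unique hm2 hD h1.1 hC h1.2 hβ

theorem quad {C : Finset (ZMod m)} (hC : C.card = 4) {a : ZMod m} (ha : a ∈ C) :
    ∃ x y z, C = {a, x, y, z} ∧ CycConsec m C a x ∧ CycConsec m C x y ∧ CycConsec m C y z ∧
      CycConsec m C z a ∧ 0 < R a x ∧ R a x < R a y ∧ R a y < R a z := by
  have c1 : (C.erase a).card = 3 := by rw [Finset.card_erase_of_mem ha, hC]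
  obtain ⟨x, hx, hxm⟩ := Finset.exists_min_image (C.erase a) (R a)
    (by rw [← Finset.card_pos]; omega)
  have c2 : ((C.erase a).erase x).card = 2 := by rw [Finset.card_erase_of_mem hx, c1]
  obtain ⟨y, hy, hym⟩ := Finset.exists_min_image ((C.erase a).erase x) (R a)
    (by rw [← Finset.card_pos]; omega)
  have c3 : (((C.erase a).erase x).erase y).card = 1 := by rw [Finset.card_erase_of_mem hy, c2]
  obtain ⟨z, hz⟩ := Finset.card_eq_one.1 c3
  have hzm : z ∈ ((C.erase a).erase x).erase y := by rw [hz]; simp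
  have heq : C = {a, x, y, z} := by
    rw [← hz, Finset.insert_erase hy, Finset.insert_erase hx, Finset.insert_erase ha]
  have l1 := hxm y (Finset.mem_of_mem_erase hy)
  have l2 := hym z (Finset.mem_of_mem_erase hzm)
  simp only [Finset.mem_erase] at hx hy hzm
  have n1 := R_ne a hx.1
  have n2 := R_ne a hy.1
  have n3 := R_ne a hzm.1
  rw [R_self] at n1
  refine ⟨x, y, z, heq, ⟨ha, hx.2, hx.1.symm, ?_⟩, ⟨hx.2, hy.2.2, hy.1.symm, ?_⟩,
    ⟨hy.2.2, hzm.2.2.2, hzm.1.symm, ?_⟩, ⟨hzm.2.2.2, ha, hzm.2.2.1, ?_⟩,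
    by omega, by omega, by omega⟩ <;>
  · intro w hw hs
    rw [heq] at hw
    simp only [Finset.mem_insert, Finset.mem_singleton] at hw
    rw [sb_iff a] at hs
    have hself := R_self a
    rcases hw with rfl | rfl | rfl | rfl <;> omega

theorem odd_len (hm : 2 ≤ m) (hD : IsPAngulation m 4 D) : ∀ n : ℕ, ∀ a b : ZMod m,
    R a b = n → (s(a, b) ∈ D ∨ b = a + 1) → n % 2 = 1 := by
  intro n
  induction n using Nat.strong_induction_on with
  | _ n ih =>
    intro a b hn h
    by_cases hb : b = a + 1
    · subst hb
      have := val_succ_sub hm a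
      unfold R at hn
      omega
    have hd : s(a, b) ∈ D := h.resolve_right hb
    have hab := (D_diag hD.1 hd).1
    obtain ⟨C, hC, hba⟩ := cell_exists hm hD.1 hab hb (Or.inl hd)
    obtain ⟨x, y, z, -, h1, h2, h3, h4, l1, l2, l3⟩ := quad (hD.2 C hC) hba.2.1
    have hz : z = b := pred_unique h4 hba
    subst hz
    have r1 := R_sub a x y
    have r2 := R_sub a y z
    have i1 := ih (R a x) (by omega) a x rfl (consec_edge hm hC h1)
    have i2 := ih (R x y) (by unfold R at *; omega) x y rfl (consec_edge hm hC h2)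
    have i3 := ih (R y z) (by unfold R at *; omega) y z rfl (consec_edge hm hC h3)
    unfold R at *
    omega

theorem black_alt (hm : 2 ≤ m) (he : m % 2 = 0) (hD : IsPAngulation m 4 D) {a b : ZMod m}
    (h : s(a, b) ∈ D ∨ b = a + 1) : IsBlack m a ↔ ¬ IsBlack m b := by
  have h1 := odd_len hm hD _ a b rfl h
  have h2 := valsub b a
  have := ZMod.val_lt a
  have := ZMod.val_lt b
  unfold IsBlack
  unfold R at h1
  omega

theorem other_black (hm : 2 ≤ m) (he : m % 2 = 0) (hD : IsPAngulation m 4 D)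
    {C : Finset (ZMod m)} (hC : IsCell m D C) {a : ZMod m} (ha : a ∈ C) (hb : IsBlack m a) :
    ∃ y ∈ C, a ≠ y ∧ IsBlack m y ∧ ∀ w ∈ C, a ≠ w → IsBlack m w → w = y := by
  obtain ⟨x, y, z, heq, h1, h2, h3, h4, l1, l2, l3⟩ := quad (hD.2 C hC) ha
  have b1 := black_alt hm he hD (consec_edge hm hC h1)
  have b2 := black_alt hm he hD (consec_edge hm hC h2)
  have b3 := black_alt hm he hD (consec_edge hm hC h3)
  refine ⟨y, h3.1, ?_, by tauto, ?_⟩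
  · rintro rfl
    rw [R_self] at l2
    omega
  · intro w hw hne hwb
    rw [heq] at hw
    simp only [Finset.mem_insert, Finset.mem_singleton] at hw
    rcases hw with rfl | rfl | rfl | rfl
    · exact absurd rfl hne
    · tauto
    · rfl
    · tauto

theorem cell_sub_black (hm : 2 ≤ m) (he : m % 2 = 0) (hD : IsPAngulation m 4 D)
    {C C' : Finset (ZMod m)} (hC : IsCell m D C) (hC' : IsCell m D C') {a b : ZMod m}
    (hab : a ≠ b) (ha : IsBlack m a) (hb : IsBlack m b) (h1 : a ∈ C) (h2 : b ∈ C)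
    (h3 : a ∈ C') (h4 : b ∈ C') : C ⊆ C' := by
  intro p hp
  by_contra hp'
  obtain ⟨u, v, g1, g2, g3, g4⟩ := cell_diff hm hD.1 hC hC' hp hp'
  have := black_alt hm he hD (Or.inl g3)
  rcases g4 a h1 h3 with ha' | ha' <;> rcases g4 b h2 h4 with hb' | hb'
  · exact hab (ha'.trans hb'.symm)
  · subst ha' hb'
    tauto
  · subst ha' hb'
    tauto
  · exact hab (ha'.trans hb'.symm)

theorem assoc_dissection (hm : 2 ≤ m) (he : m % 2 = 0) (hD : IsPAngulation m 4 D) :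
    IsDissection m (assocTriangulation m D) := by
  refine ⟨?_, ?_⟩
  · rintro e (h | ⟨C, a, b, hC, rfl, ha, hb, hab, hba, hbb⟩)
    · exact hD.1.1 e h
    · refine ⟨a, b, rfl, hab, ?_, ?_⟩
      · intro h
        have := black_alt hm he hD (Or.inr h)
        tauto
      · intro h
        have := black_alt hm he hD (Or.inr h)
        tauto
  · rintro e he' f hf ⟨a, b, c, d, rfl, rfl, h1, h2⟩
    -- reduce odd pairs to canonical form
    have canon : ∀ a b, s(a, b) ∈ oddPairs m D → ∃ C, IsCell m D C ∧ a ∈ C ∧ b ∈ C ∧ a ≠ b ∧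
        IsBlack m a ∧ IsBlack m b := by
      rintro a b ⟨C, a', b', hC, heq, g1, g2, g3, g4, g5⟩
      rw [Sym2.eq_iff] at heq
      rcases heq with ⟨rfl, rfl⟩ | ⟨rfl, rfl⟩
      · exact ⟨C, hC, g1, g2, g3, g4, g5⟩
      · exact ⟨C, hC, g2, g1, g3.symm, g5, g4⟩
    rcases he' with he' | he' <;> rcases hf with hf | hf
    · exact NC hD.1 he' hf h1 h2
    · obtain ⟨C, hC, g1, g2, -, -, -⟩ := canon _ _ hf
      exact sep hm hD.1 hC he' g1 g2 h1 h2
    · obtain ⟨C, hC, g1, g2, -, -, -⟩ := canon _ _ he'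
      refine sep hm hD.1 hC hf g2 g1 ?_ ?_ <;> rw [sb_iff 0] at * <;> omega
    · obtain ⟨C, hC, g1, g2, g3, g4, g5⟩ := canon _ _ he'
      obtain ⟨C', hC', k1, k2, k3, k4, k5⟩ := canon _ _ hf
      obtain ⟨y, -, -, -, hy⟩ := other_black hm he hD hC g1 g4
      have hby := hy b g2 g3 g5
      have n1 := sb_ne h1
      have n2 := sb_ne h2
      have hc : c ∉ C := fun hc => n1.2.1 ((hy c hc n1.1 k4).trans hby.symm)
      have hd : d ∉ C := fun hd => n2.1 (hby.trans (hy d hd n2.2.1.symm k5).symm)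
      obtain ⟨u, v, p1, p2, p3⟩ := gap_D hm hC hc
      have q1 : ¬ StrictBtw m v d u := fun hh => sep hm hD.1 hC' p3 k1 k2 p2 hh
      have q2 := p1.2.2.2 a g1
      have q3 := p1.2.2.2 b g2
      have q4 := R_ne 0 (fun h => hd (h ▸ p1.1) : u ≠ d)
      have q5 := R_ne 0 (fun h => hd (h ▸ p1.2.1) : v ≠ d)
      rw [sb_iff 0] at *
      omega

theorem white_count (hm : 3 ≤ m) (he : m % 2 = 0) (hD : IsPAngulation m 4 D) {α : ZMod m}
    (hα : ¬ IsBlack m α) : cellCount m (assocTriangulation m D) α = cellCount m D α := by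
  rw [cellCount_eq hm hD.1, cellCount_eq hm (assoc_dissection (by omega) he hD)]
  congr 2
  ext β
  simp only [Set.mem_ofPred_eq, assocTriangulation, Set.mem_union, or_iff_left_iff_imp]
  rintro ⟨C, a, b, hC, heq, g1, g2, g3, g4, g5⟩
  rw [Sym2.eq_iff] at heq
  rcases heq with ⟨rfl, rfl⟩ | ⟨rfl, rfl⟩
  · exact absurd g4 hα
  · exact absurd g5 hα

theorem black_count (hm : 3 ≤ m) (he : m % 2 = 0) (hD : IsPAngulation m 4 D) {α : ZMod m}
    (hα : IsBlack m α) : cellCount m (assocTriangulation m D) α = 2 * cellCount m D α := by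
  have hm2 : 2 ≤ m := by omega
  have e1 := cellCount_eq hm hD.1 α
  rw [cellCount_eq hm (assoc_dissection (by omega) he hD)]
  have hun : {β | s(α, β) ∈ assocTriangulation m D} =
      {β | s(α, β) ∈ D} ∪ {β | s(α, β) ∈ oddPairs m D} := rfl
  have hodd : ∀ β, s(α, β) ∈ oddPairs m D → ∃ C, IsCell m D C ∧ α ∈ C ∧ β ∈ C ∧ α ≠ β ∧
      IsBlack m β := by
    rintro β ⟨C, a, b, hC, heq, g1, g2, g3, g4, g5⟩
    rw [Sym2.eq_iff] at heq
    rcases heq with ⟨rfl, rfl⟩ | ⟨rfl, rfl⟩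
    · exact ⟨C, hC, g1, g2, g3, g5⟩
    · exact ⟨C, hC, g2, g1, g3.symm, g4⟩
  have hdis : Disjoint {β | s(α, β) ∈ D} {β | s(α, β) ∈ oddPairs m D} := by
    rw [Set.disjoint_left]
    intro β h1 h2
    obtain ⟨C, -, -, -, -, hb⟩ := hodd β h2
    have := black_alt hm2 he hD (Or.inl h1)
    tauto
  have e2 : cellCount m D α = {β | s(α, β) ∈ oddPairs m D}.ncard := by
    unfold cellCount
    have ex : ∀ C ∈ {C : Finset (ZMod m) | IsCell m D C ∧ α ∈ C}, ∃ y ∈ C, α ≠ y ∧ IsBlack m y ∧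
        ∀ w ∈ C, α ≠ w → IsBlack m w → w = y :=
      fun C hC => other_black hm2 he hD hC.1 hC.2 hα
    refine Set.ncard_congr (fun C hC => (ex C hC).choose) ?_ ?_ ?_
    · intro C hC
      obtain ⟨g1, g2, g3, -⟩ := (ex C hC).choose_spec
      exact ⟨C, α, _, hC.1, rfl, hC.2, g1, g2, hα, g3⟩
    · intro C C' hC hC' heq
      obtain ⟨g1, g2, g3, -⟩ := (ex C hC).choose_spec
      obtain ⟨k1, k2, k3, -⟩ := (ex C' hC').choose_spec
      have heq' : (ex C hC).choose = (ex C' hC').choose := heq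
      rw [← heq'] at k1
      exact Finset.Subset.antisymm
        (cell_sub_black hm2 he hD hC.1 hC'.1 g2 hα g3 hC.2 g1 hC'.2 k1)
        (cell_sub_black hm2 he hD hC'.1 hC.1 g2 hα g3 hC'.2 k1 hC.2 g1)
    · intro β hβ
      obtain ⟨C, hC, g1, g2, g3, g4⟩ := hodd β hβ
      refine ⟨C, ⟨hC, g1⟩, ?_⟩
      exact ((ex C ⟨hC, g1⟩).choose_spec.2.2.2 β g2 g3 g4).symm
  rw [hun, Set.ncard_union_eq hdis (Set.toFinite _) (Set.toFinite _)]
  omega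

end Helpers

/-- Row `3` of the frieze of type `Λ_4` of a quadrangulation `D` of the
`(2s+2)`-gon and row `3` of the Conway–Coxeter frieze of the associated
triangulation coincide: both have entries `2 q_k q_{k+1} - 1` (indices modulo
`2s+2`), and these entries are positive integers. -/
theorem stmt8 (s : ℕ) (hs : 1 ≤ s) (D : Set (Sym2 (ZMod (2 * s + 2))))
    (hD : IsPAngulation (2 * s + 2) 4 D)
    (F G : Frieze (2 * s - 1))
    (hF : FriezeOfPAng 4 (2 * s + 2) F D)
    (hG : CCFrieze (2 * s + 2) G (assocTriangulation (2 * s + 2) D)) :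
    ∀ k : ℤ,
      F.entry 3 k =
        2 * (cellCount (2 * s + 2) D (k : ZMod (2 * s + 2)) : ℝ) *
          (cellCount (2 * s + 2) D ((k + 1 : ℤ) : ZMod (2 * s + 2)) : ℝ) - 1 ∧
      G.entry 3 k =
        2 * (cellCount (2 * s + 2) D (k : ZMod (2 * s + 2)) : ℝ) *
          (cellCount (2 * s + 2) D ((k + 1 : ℤ) : ZMod (2 * s + 2)) : ℝ) - 1 ∧
      ∃ z : ℤ, 0 < z ∧ F.entry 3 k = (z : ℝ) := by
  intro k
  have hl : lambda 4 * lambda 4 = 2 := by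
    unfold lambda
    have h4 : Real.pi / ((4 : ℕ) : ℝ) = Real.pi / 4 := by norm_num
    rw [h4, Real.cos_pi_div_four]
    have := Real.mul_self_sqrt (show (0 : ℝ) ≤ 2 by norm_num)
    linarith
  have dF := F.diamond 2 k (by omega) (by omega)
  have dG := G.diamond 2 k (by omega) (by omega)
  have pF := F.row_pos 2 k le_rfl (by omega)
  have pF' := F.row_pos 2 (k + 1) le_rfl (by omega)
  norm_num at dF dG
  rw [F.row_one, hF, hF] at dF
  rw [G.row_one, hG, hG] at dG
  rw [hF] at pF pF'
  have hbl : IsBlack (2 * s + 2) (k : ZMod (2 * s + 2)) ↔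
      ¬ IsBlack (2 * s + 2) ((k + 1 : ℤ) : ZMod (2 * s + 2)) :=
    black_alt (by omega) (by omega) hD (Or.inr (by push_cast; rfl))
  have hprod : cellCount (2 * s + 2) (assocTriangulation (2 * s + 2) D) (k : ZMod (2 * s + 2)) *
      cellCount (2 * s + 2) (assocTriangulation (2 * s + 2) D) ((k + 1 : ℤ) : ZMod (2 * s + 2)) =
      2 * cellCount (2 * s + 2) D (k : ZMod (2 * s + 2)) *
        cellCount (2 * s + 2) D ((k + 1 : ℤ) : ZMod (2 * s + 2)) := by
    by_cases hk : IsBlack (2 * s + 2) (k : ZMod (2 * s + 2))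
    · rw [black_count (by omega) (by omega) hD hk,
        white_count (by omega) (by omega) hD (hbl.1 hk)]
    · rw [white_count (by omega) (by omega) hD hk,
        black_count (by omega) (by omega) hD (by tauto)]
      ring
  have hprodR := congrArg (Nat.cast : ℕ → ℝ) hprod
  generalize cellCount (2 * s + 2) D (k : ZMod (2 * s + 2)) = q at *
  generalize cellCount (2 * s + 2) D ((k + 1 : ℤ) : ZMod (2 * s + 2)) = q' at *
  push_cast at hprodR
  have eF : F.entry 3 k = 2 * (q : ℝ) * (q' : ℝ) - 1 := by
    have : lambda 4 * (q : ℝ) * (lambda 4 * (q' : ℝ)) = 2 * q * q' := by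
      rw [← hl]; ring
    linarith
  refine ⟨eF, ?_, 2 * (q : ℤ) * q' - 1, ?_, ?_⟩
  · push_cast at dG
    linarith
  · have h1 : q ≠ 0 := by rintro rfl; simp at pF
    have h2 : q' ≠ 0 := by rintro rfl; simp at pF'
    have h3 : 0 < q * q' := Nat.mul_pos (Nat.pos_of_ne_zero h1) (Nat.pos_of_ne_zero h2)
    have h4 : (0 : ℤ) < (q : ℤ) * q' := by exact_mod_cast h3
    have : 2 * (q : ℤ) * q' = 2 * ((q : ℤ) * q') := by ring
    omega
  · rw [eF]; push_cast; ring

end FriezeNote
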